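/- Let A be a unital C*-algebra admitting a dense subset of cardinality strictly less than the bounding number 𝔟, and let (u_n)_{n∈ℕ} be a central sequence of unitaries in A. Then there exists a strictly increasing sequence (n(i))_{i∈ℕ} of natural numbers such that, setting v_k = u_{n(1)} u_{n(2)} ⋯ u_{n(k)}, for every a ∈ A the sequence (v_k a v_k*)_{k∈ℕ} converges in norm, and the pointwise limit a ↦ lim_k v_k a v_k* is a unital *-endomorphism of A. -/

import Mathlib

universe u

/-- `g` eventually dominates `f`. -/
def EventuallyDominates (g f : ℕ → ℕ) : Prop :=
  ∀ᶠ n in Filter.atTop, f n ≤ g n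

/-- The bounding number `𝔟`: the least cardinality of a family `F` of functions `ℕ → ℕ`
such that no single `g : ℕ → ℕ` eventually dominates every member of `F`. -/
noncomputable def boundingNumber : Cardinal :=
  sInf { κ | ∃ F : Set (ℕ → ℕ), Cardinal.mk F = κ ∧
    ∀ g : ℕ → ℕ, ∃ f ∈ F, ¬ EventuallyDominates g f }

/-- A bounded sequence in a C*-algebra is central if it asymptotically commutes with
every element. -/
def IsCentralSequence {A : Type*} [CStarAlgebra A] (x : ℕ → A) : Prop :=
  (∃ C : ℝ, ∀ n, ‖x n‖ ≤ C) ∧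
    ∀ a : A, Filter.Tendsto (fun n => ‖x n * a - a * x n‖) Filter.atTop (nhds 0)

open Filter Topology

/-- A family of functions `ℕ → ℕ` indexed by a type of cardinality less than `𝔟` is eventually
dominated by a single function. -/
theorem exists_eventuallyDominates_of_mk_lt_boundingNumber {ι : Type u}
    (hι : Cardinal.mk ι < Cardinal.lift.{u} boundingNumber) (f : ι → ℕ → ℕ) :
    ∃ g : ℕ → ℕ, ∀ i, EventuallyDominates g (f i) := by
  by_contra! h
  have hle : boundingNumber ≤ Cardinal.mk (Set.range f) :=
    csInf_le' ⟨Set.range f, rfl, fun g => by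
      obtain ⟨i, hi⟩ := h g
      exact ⟨f i, ⟨i, rfl⟩, hi⟩⟩
  have hrange : Cardinal.lift.{u} (Cardinal.mk (Set.range f)) ≤ Cardinal.mk ι := by
    simpa using Cardinal.mk_range_le_lift (f := f)
  exact absurd (hι.trans_le ((Cardinal.lift_le.2 hle).trans hrange)) (lt_irrefl _)

/-- Every function `ℕ → ℕ` is bounded by a strictly increasing one. -/
theorem exists_strictMono_ge (g : ℕ → ℕ) : ∃ n : ℕ → ℕ, StrictMono n ∧ ∀ k, g k ≤ n k := by
  refine ⟨fun k => k + ∑ i ∈ Finset.range (k + 1), g i, strictMono_nat_of_lt_succ fun k => ?_,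
    fun k => ?_⟩
  · have := Finset.sum_range_succ g (k + 1)
    omega
  · have := Finset.sum_range_succ g k
    dsimp only
    omega

section UnitaryConjugation

variable {A : Type*} [CStarAlgebra A]

theorem norm_unitary_conj {v : A} (hv : v ∈ unitary A) (a : A) : ‖v * a * star v‖ = ‖a‖ := by
  rw [CStarRing.norm_mul_mem_unitary _ (Unitary.star_mem hv), CStarRing.norm_mem_unitary_mul _ hv]

theorem norm_unitary_conj_sub_self {w : A} (hw : w ∈ unitary A) (a : A) :
    ‖w * a * star w - a‖ = ‖w * a - a * w‖ := by
  rw [← CStarRing.norm_mul_mem_unitary (w * a * star w - a) hw, sub_mul, mul_assoc (w * a),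
    Unitary.star_mul_self_of_mem hw, mul_one]

theorem norm_unitary_mul_conj_sub {v w : A} (hv : v ∈ unitary A) (hw : w ∈ unitary A) (a : A) :
    ‖(v * w) * a * star (v * w) - v * a * star v‖ = ‖w * a - a * w‖ := by
  rw [← norm_unitary_conj_sub_self hw, ← norm_unitary_conj hv (w * a * star w - a), star_mul]
  congr 1
  noncomm_ring

/-- Conjugation by a sequence of unitaries is Cauchy at every point as soon as it is so at the
points of a dense set. -/
theorem cauchySeq_unitary_conj_of_dense {v : ℕ → A} (hv : ∀ k, v k ∈ unitary A) {s : Set A}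
    (hs : Dense s) (h : ∀ b ∈ s, CauchySeq fun k => v k * b * star (v k)) (a : A) :
    CauchySeq fun k => v k * a * star (v k) := by
  rw [Metric.cauchySeq_iff]
  intro ε hε
  obtain ⟨b, hb, hab⟩ := hs.exists_dist_lt a (show 0 < ε / 3 by positivity)
  obtain ⟨N, hN⟩ := Metric.cauchySeq_iff.1 (h b hb) (ε / 3) (by positivity)
  have hdist (k : ℕ) : dist (v k * a * star (v k)) (v k * b * star (v k)) = dist a b := by
    rw [dist_eq_norm, dist_eq_norm, ← sub_mul, ← mul_sub, norm_unitary_conj (hv k)]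
  refine ⟨N, fun i hi j hj => ?_⟩
  have htri := dist_triangle4 (v i * a * star (v i)) (v i * b * star (v i))
    (v j * b * star (v j)) (v j * a * star (v j))
  have hij := hN i hi j hj
  rw [hdist, dist_comm (v j * b * star (v j)), hdist] at htri
  linarith

/-- A pointwise norm limit of inner automorphisms is a unital `*`-endomorphism. -/
theorem exists_starAlgHom_tendsto_unitary_conj {v : ℕ → A} (hv : ∀ k, v k ∈ unitary A)
    (h : ∀ a, CauchySeq fun k => v k * a * star (v k)) :
    ∃ α : A →⋆ₐ[ℂ] A, ∀ a, Tendsto (fun k => v k * a * star (v k)) atTop (𝓝 (α a)) := by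
  choose φ hφ using fun a => cauchySeq_tendsto_of_complete (h a)
  have halg (r : ℂ) : φ (algebraMap ℂ A r) = algebraMap ℂ A r := by
    refine tendsto_nhds_unique (hφ _) (tendsto_const_nhds.congr fun k => ?_)
    rw [← Algebra.commutes, mul_assoc, Unitary.mul_star_self_of_mem (hv k), mul_one]
  refine ⟨{ toFun := φ
            map_one' := by simpa using halg 1
            map_zero' := by simpa using halg 0
            map_mul' := fun a b => ?_
            map_add' := fun a b => ?_
            commutes' := halg
            map_star' := fun a => ?_ }, hφ⟩
  · refine tendsto_nhds_unique (hφ _) (((hφ a).mul (hφ b)).congr fun k => ?_)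
    calc v k * a * star (v k) * (v k * b * star (v k))
        = v k * a * (star (v k) * v k) * b * star (v k) := by noncomm_ring
      _ = v k * (a * b) * star (v k) := by
        rw [Unitary.star_mul_self_of_mem (hv k)]; noncomm_ring
  · refine tendsto_nhds_unique (hφ _) (((hφ a).add (hφ b)).congr fun k => ?_)
    rw [mul_add, add_mul]
  · refine tendsto_nhds_unique (hφ _) ((hφ a).star.congr fun k => ?_)
    simp [mul_assoc]

end UnitaryConjugation

/-- If `A` has a dense subset of cardinality `< 𝔟` and `(u n)` is a central
sequence of unitaries, then along some strictly increasing subsequence the inner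
automorphisms `Ad (u (n 0) * ⋯ * u (n (k-1)))` converge pointwise in norm to a unital
*-endomorphism of `A`. -/
theorem stmt_9 {A : Type u} [CStarAlgebra A]
    (hA : ∃ s : Set A, Dense s ∧ Cardinal.mk s < Cardinal.lift.{u} boundingNumber)
    (u : ℕ → A) (hu : ∀ k, u k ∈ unitary A) (hcentral : IsCentralSequence u) :
    ∃ n : ℕ → ℕ, StrictMono n ∧ ∃ α : A →⋆ₐ[ℂ] A,
      ∀ a : A, Filter.Tendsto
        (fun k => ((List.range k).map (fun i => u (n i))).prod * a *
          star ((List.range k).map (fun i => u (n i))).prod)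
        Filter.atTop (nhds (α a)) := by
  obtain ⟨s, hs, hcard⟩ := hA
  have hrate (a : A) (k : ℕ) : ∃ N, ∀ m ≥ N, ‖u m * a - a * u m‖ < (1 / 2 : ℝ) ^ k :=
    eventually_atTop.1 ((hcentral.2 a).eventually_lt_const (by positivity))
  choose f hf using hrate
  obtain ⟨g, hg⟩ := exists_eventuallyDominates_of_mk_lt_boundingNumber hcard fun a : s => f a
  obtain ⟨n, hn, hgn⟩ := exists_strictMono_ge g
  refine ⟨n, hn, ?_⟩
  have hv (k : ℕ) : ((List.range k).map fun i => u (n i)).prod ∈ unitary A :=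
    Submonoid.list_prod_mem _ (by simp [hu])
  refine exists_starAlgHom_tendsto_unitary_conj hv
    (cauchySeq_unitary_conj_of_dense hv hs fun b hb => ?_)
  refine cauchySeq_of_summable_dist (Summable.of_norm_bounded_eventually_nat
    (summable_geometric_of_lt_one (by norm_num) (by norm_num : (1 / 2 : ℝ) < 1)) ?_)
  filter_upwards [hg ⟨b, hb⟩] with k hk
  rw [Real.norm_of_nonneg dist_nonneg, dist_comm, dist_eq_norm, List.prod_range_succ,
    norm_unitary_mul_conj_sub (hv k) (hu _)]
  exact (hf b k _ (hk.trans (hgn k))).le
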